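/- Every real n×p matrix X has a pseudo-inverse: there exists a p×n real matrix X⁺ satisfying the four Penrose conditions (C1) X X⁺ X = X, (C2) X⁺ X X⁺ = X⁺, (C3) (X X⁺)ᵀ = X X⁺, and (C4) (X⁺ X)ᵀ = X⁺ X. -/

import Mathlib

open Matrix

/-- A real symmetric matrix has a symmetric generalized inverse commuting with it. -/
theorem Matrix.IsHermitian.exists_commuting_pseudo_inverse {m : Type*} [Fintype m]
    [DecidableEq m] {A : Matrix m m ℝ} (hA : A.IsHermitian) :
    ∃ G : Matrix m m ℝ, Gᵀ = G ∧ A * G = G * A ∧ A * G * A = A ∧ G * A * G = G := by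
  obtain ⟨U, d, hU, rfl⟩ : ∃ (U : Matrix m m ℝ) (d : m → ℝ),
      Uᵀ * U = 1 ∧ A = U * diagonal d * Uᵀ := by
    refine ⟨hA.eigenvectorUnitary, hA.eigenvalues, ?_, ?_⟩
    · simpa [star_eq_conjTranspose] using Unitary.coe_star_mul_self hA.eigenvectorUnitary
    · simpa [Unitary.conjStarAlgAut_apply, star_eq_conjTranspose, Function.comp_def]
        using hA.spectral_theorem
  have conj_mul (a b : m → ℝ) : U * diagonal a * Uᵀ * (U * diagonal b * Uᵀ) =
      U * diagonal (fun i => a i * b i) * Uᵀ := by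
    calc U * diagonal a * Uᵀ * (U * diagonal b * Uᵀ)
        = U * diagonal a * (Uᵀ * U) * diagonal b * Uᵀ := by simp only [Matrix.mul_assoc]
      _ = U * diagonal (fun i => a i * b i) * Uᵀ := by
        rw [hU, Matrix.mul_one, Matrix.mul_assoc U, diagonal_mul_diagonal]
  refine ⟨U * diagonal (fun i => (d i)⁻¹) * Uᵀ, ?_, ?_, ?_, ?_⟩
  · simp [Matrix.mul_assoc]
  · simp only [conj_mul, mul_comm]
  · simp only [conj_mul, mul_inv_mul_cancel]
  · have h (x : ℝ) : x⁻¹ * x * x⁻¹ = x⁻¹ := by simpa using mul_inv_mul_cancel x⁻¹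
    simp only [conj_mul, h]

/-- Existence of the Moore–Penrose pseudo-inverse: every real `n × p`
matrix has a `p × n` matrix satisfying the four Penrose conditions. -/
theorem pseudo_inverse_exists (n p : ℕ) (X : Matrix (Fin n) (Fin p) ℝ) :
    ∃ Xp : Matrix (Fin p) (Fin n) ℝ,
      X * Xp * X = X ∧
      Xp * X * Xp = Xp ∧
      (X * Xp)ᵀ = X * Xp ∧
      (Xp * X)ᵀ = Xp * X := by
  obtain ⟨G, hG, hcomm, hAGA, hGAG⟩ :=
    (isHermitian_conjTranspose_mul_self X).exists_commuting_pseudo_inverse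
  rw [conjTranspose_eq_transpose_of_trivial] at hcomm hAGA hGAG
  refine ⟨G * Xᵀ, ?_, ?_, ?_, ?_⟩
  · have h : Xᴴ * X * (G * (Xᵀ * X) - 1) = 0 := by
      rw [conjTranspose_eq_transpose_of_trivial, Matrix.mul_sub, ← Matrix.mul_assoc, hAGA,
        Matrix.mul_one, sub_self]
    rw [conjTranspose_mul_self_mul_eq_zero, Matrix.mul_sub, Matrix.mul_one, sub_eq_zero] at h
    simpa only [Matrix.mul_assoc] using h
  · calc G * Xᵀ * X * (G * Xᵀ) = G * (Xᵀ * X) * G * Xᵀ := by simp only [Matrix.mul_assoc]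
      _ = G * Xᵀ := by rw [hGAG]
  · simp only [transpose_mul, transpose_transpose, hG, Matrix.mul_assoc]
  · rw [Matrix.mul_assoc, ← hcomm]
    simp only [transpose_mul, transpose_transpose, hG, hcomm]
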